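/- For ω ∈ ℝ one has Ai(−ω) = 0 if and only if L(ω) = 2πk for some integer k ≥ 1; in particular L(ω_k) = 2πk for every k ≥ 1, and moreover L'(ω_k) = 2π ∫_0^∞ Ai(x − ω_k)² dx. -/

import Mathlib

open Real Complex Filter MeasureTheory

/-- `A₊(z) = e^{-iπ/3} Ai(e^{-iπ/3} z)`. -/
noncomputable def Aplus (Ai : ℂ → ℂ) (z : ℂ) : ℂ :=
  Complex.exp (-(Real.pi / 3 : ℂ) * Complex.I) * Ai (Complex.exp (-(Real.pi / 3 : ℂ) * Complex.I) * z)

/-- `A₋(z) = e^{iπ/3} Ai(e^{iπ/3} z)`. -/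
noncomputable def Aminus (Ai : ℂ → ℂ) (z : ℂ) : ℂ :=
  Complex.exp ((Real.pi / 3 : ℂ) * Complex.I) * Ai (Complex.exp ((Real.pi / 3 : ℂ) * Complex.I) * z)

/-- A solution of `y'' = q y` on the real line with vanishing Cauchy data at `0` is zero. -/
theorem eq_zero_of_second_order_linear {q : ℝ → ℂ} (hq : Continuous q) {y y' : ℝ → ℂ}
    (hy : ∀ t, HasDerivAt y (y' t) t) (hy' : ∀ t, HasDerivAt y' (q t * y t) t)
    (h0 : y 0 = 0) (h0' : y' 0 = 0) (t : ℝ) : y t = 0 := by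
  set R : ℝ := |t| + 1 with hR
  obtain ⟨C, hC⟩ := (isCompact_Icc (a := -R) (b := R)).exists_bound_of_continuousOn
    hq.continuousOn
  have hRpos : 0 < R := by positivity
  have key := ODE_solution_unique_of_mem_Ioo (E := ℂ × ℂ)
    (v := fun t p => (p.2, q t * p.1)) (s := fun _ => Set.univ)
    (K := Real.toNNReal (max 1 C)) (f := fun t => (y t, y' t)) (g := fun _ => (0, 0))
    (a := -R) (b := R) (t₀ := 0) ?_ ⟨by linarith, hRpos⟩ ?_ ?_ (by simp [h0, h0'])
  · have ht : t ∈ Set.Ioo (-R) R := by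
      constructor
      · linarith [neg_abs_le t]
      · linarith [le_abs_self t]
    exact congrArg Prod.fst (key ht)
  · intro s hs
    apply LipschitzWith.lipschitzOnWith
    apply LipschitzWith.of_dist_le_mul
    rintro ⟨a, b⟩ ⟨c, d⟩
    have hqs := hC s ⟨hs.1.le, hs.2.le⟩
    rw [Real.coe_toNNReal _ (by positivity)]
    change max (dist b d) (dist (q s * a) (q s * c)) ≤ _ * max (dist a c) (dist b d)
    simp only [dist_eq_norm, ← mul_sub, norm_mul]
    apply max_le
    · calc ‖b - d‖ ≤ max ‖a - c‖ ‖b - d‖ := le_max_right _ _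
        _ = 1 * max ‖a - c‖ ‖b - d‖ := (one_mul _).symm
        _ ≤ _ := by gcongr; exact le_max_left _ _
    · gcongr
      · exact hqs.trans (le_max_right _ _)
      · exact le_max_left _ _
  · intro s _
    exact ⟨(hy s).prodMk (hy' s), trivial⟩
  · intro s _
    refine ⟨?_, trivial⟩
    have : ((0 : ℂ), q s * (0 : ℂ)) = 0 := by simp
    simp only [this]
    exact hasDerivAt_const _ _

/-- The primitive cube root of unity `e^{2πi/3}`. -/
noncomputable def cubeRoot : ℂ := ⟨-1 / 2, √3 / 2⟩

theorem cubeRoot_sq : cubeRoot ^ 2 = ⟨-1 / 2, -(√3 / 2)⟩ := by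
  have h : √3 * √3 = 3 := Real.mul_self_sqrt (by norm_num)
  rw [pow_two]
  apply Complex.ext <;> simp [cubeRoot] <;> nlinarith

theorem cubeRoot_pow_three : cubeRoot ^ 3 = 1 := by
  have h : √3 * √3 = 3 := Real.mul_self_sqrt (by norm_num)
  rw [pow_succ, cubeRoot_sq]
  apply Complex.ext <;> simp [cubeRoot] <;> nlinarith

/-- The integrand `s ^ k * exp (-s³/3 + x e^{2πi/3} s)`, obtained from the Airy integral by
rotating the contour. -/
noncomputable def airyKernel (k : ℕ) (x s : ℝ) : ℂ :=
  (s : ℂ) ^ k * Complex.exp (-(s : ℂ) ^ 3 / 3 + x * cubeRoot * s)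

theorem norm_airyKernel (k : ℕ) (x : ℝ) {s : ℝ} (hs : 0 ≤ s) :
    ‖airyKernel k x s‖ = s ^ k * Real.exp (-s ^ 3 / 3 - x * s / 2) := by
  rw [airyKernel, norm_mul, norm_pow, Complex.norm_real, Real.norm_of_nonneg hs,
    Complex.norm_exp]
  congr 2
  have : (-(s : ℂ) ^ 3 / 3 + x * cubeRoot * s) =
      ((-s ^ 3 / 3 : ℝ) : ℂ) + ((x * s : ℝ) : ℂ) * cubeRoot := by push_cast; ring
  rw [this, Complex.add_re, Complex.ofReal_re, Complex.re_ofReal_mul]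
  simp only [cubeRoot]
  ring

theorem norm_airyKernel_le (k : ℕ) {x R s : ℝ} (hx : |x| ≤ R) (hs : 0 ≤ s) :
    ‖airyKernel k x s‖ ≤
      Real.exp ((R + 1) * (3 * R + 4)) * (Real.exp (-s) * s ^ ((k + 1 : ℝ) - 1)) := by
  have hR : 0 ≤ R := (abs_nonneg x).trans hx
  rw [norm_airyKernel k x hs, add_sub_cancel_right, Real.rpow_natCast, ← mul_assoc,
    ← Real.exp_add, mul_comm]
  gcongr
  have h1 : -(x * s) ≤ R * s := by nlinarith [neg_abs_le x]
  have h2 : 0 ≤ R * s := by positivity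
  rcases le_or_gt s (3 * R + 4) with h | h
  · have : 0 ≤ s ^ 3 := by positivity
    nlinarith
  · have h3 : 3 * (R + 1) ≤ s ^ 2 := by nlinarith
    have h4 : 3 * (R + 1) * s ≤ s ^ 3 := by
      calc _ ≤ s ^ 2 * s := by gcongr
        _ = _ := by ring
    nlinarith

theorem continuous_airyKernel (k : ℕ) (x : ℝ) : Continuous (airyKernel k x) := by
  unfold airyKernel
  fun_prop

theorem integrableOn_airyKernel_bound (k : ℕ) (R : ℝ) :
    IntegrableOn (fun s : ℝ => Real.exp ((R + 1) * (3 * R + 4)) *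
      (Real.exp (-s) * s ^ ((k + 1 : ℝ) - 1))) (Set.Ioi 0) :=
  (Real.GammaIntegral_convergent (by positivity)).const_mul _

theorem integrableOn_airyKernel (k : ℕ) (x : ℝ) :
    IntegrableOn (airyKernel k x) (Set.Ioi 0) := by
  refine (integrableOn_airyKernel_bound k |x|).mono'
    (continuous_airyKernel k x).aestronglyMeasurable ?_
  filter_upwards [ae_restrict_mem measurableSet_Ioi] with s hs
  exact norm_airyKernel_le k le_rfl (le_of_lt hs)

/-- The moments of the rotated Airy integral. -/
noncomputable def airyMoment (k : ℕ) (x : ℝ) : ℂ := ∫ s in Set.Ioi (0 : ℝ), airyKernel k x s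

theorem hasDerivAt_airyKernel (k : ℕ) (x s : ℝ) :
    HasDerivAt (fun x => airyKernel k x s) (cubeRoot * airyKernel (k + 1) x s) x := by
  have h : HasDerivAt (fun z : ℂ => (s : ℂ) ^ k * Complex.exp (-(s : ℂ) ^ 3 / 3 + z * cubeRoot * s))
      ((s : ℂ) ^ k * (Complex.exp (-(s : ℂ) ^ 3 / 3 + x * cubeRoot * s) * (1 * cubeRoot * s))) x :=
    (((((hasDerivAt_id (x : ℂ)).mul_const cubeRoot).mul_const (s : ℂ)).const_add
      (-(s : ℂ) ^ 3 / 3)).cexp).const_mul _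
  refine h.comp_ofReal.congr_deriv ?_
  simp only [airyKernel]
  ring

theorem hasDerivAt_airyMoment (k : ℕ) (x : ℝ) :
    HasDerivAt (airyMoment k) (cubeRoot * airyMoment (k + 1) x) x := by
  have h := (hasDerivAt_integral_of_dominated_loc_of_deriv_le
    (μ := volume.restrict (Set.Ioi (0 : ℝ))) (F := airyKernel k) (x₀ := x)
    (s := Metric.ball x 1) (F' := fun x s => cubeRoot * airyKernel (k + 1) x s)
    (bound := fun s => ‖cubeRoot‖ * (Real.exp ((|x| + 1 + 1) * (3 * (|x| + 1) + 4)) *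
      (Real.exp (-s) * s ^ (((k + 1 : ℕ) + 1 : ℝ) - 1))))
    (Metric.ball_mem_nhds x one_pos)
    (Eventually.of_forall fun y => (continuous_airyKernel k y).aestronglyMeasurable)
    (integrableOn_airyKernel k x)
    ((continuous_airyKernel (k + 1) x).const_smul cubeRoot).aestronglyMeasurable ?_
    ((integrableOn_airyKernel_bound (k + 1) _).const_mul _)
    (Eventually.of_forall fun s y _ => hasDerivAt_airyKernel k y s)).2
  · rw [integral_const_mul] at h
    exact h
  · filter_upwards [ae_restrict_mem measurableSet_Ioi] with s hs y hy
    rw [norm_mul]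
    gcongr
    apply norm_airyKernel_le _ _ (le_of_lt hs)
    rw [Metric.mem_ball, Real.dist_eq] at hy
    have := abs_sub_abs_le_abs_sub y x
    linarith

theorem tendsto_airyKernel_zero_atTop (x : ℝ) :
    Tendsto (airyKernel 0 x) atTop (nhds 0) := by
  rw [tendsto_zero_iff_norm_tendsto_zero]
  have h : Tendsto (fun s : ℝ => Real.exp ((|x| + 1) * (3 * |x| + 4)) * Real.exp (-s)) atTop
      (nhds 0) := by
    simpa using (Real.tendsto_exp_neg_atTop_nhds_zero).const_mul
      (Real.exp ((|x| + 1) * (3 * |x| + 4)))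
  refine squeeze_zero' (Eventually.of_forall fun _ => norm_nonneg _) ?_ h
  filter_upwards [eventually_ge_atTop 0] with s hs
  simpa using norm_airyKernel_le 0 (le_refl |x|) hs

theorem airyMoment_two (x : ℝ) : airyMoment 2 x = 1 + x * cubeRoot * airyMoment 0 x := by
  have hd : ∀ s ∈ Set.Ici (0 : ℝ), HasDerivAt (airyKernel 0 x)
      (x * cubeRoot * airyKernel 0 x s - airyKernel 2 x s) s := by
    intro s _
    have h : HasDerivAt (fun z : ℂ => Complex.exp (-z ^ 3 / 3 + x * cubeRoot * z))
        (Complex.exp (-(s : ℂ) ^ 3 / 3 + x * cubeRoot * s) *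
          (-(((3 : ℕ) : ℂ) * (s : ℂ) ^ 2) / 3 + x * cubeRoot * 1)) (s : ℂ) :=
      ((((hasDerivAt_pow 3 (s : ℂ)).neg).div_const 3).add
        ((hasDerivAt_id (s : ℂ)).const_mul (x * cubeRoot))).cexp
    convert h.comp_ofReal using 1
    · funext t
      simp [airyKernel]
    · simp only [airyKernel]
      push_cast
      ring
  have h1 := ((integrableOn_airyKernel 0 x).integrable.const_mul (x * cubeRoot))
  have h2 := (integrableOn_airyKernel 2 x).integrable
  have h := integral_Ioi_of_hasDerivAt_of_tendsto' hd (h1.sub h2)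
    (tendsto_airyKernel_zero_atTop x)
  rw [integral_sub h1 h2, integral_const_mul] at h
  simp only [← airyMoment.eq_def] at h
  have h0 : airyKernel 0 x 0 = 1 := by simp [airyKernel]
  rw [h0] at h
  linear_combination -h

theorem norm_airyMoment_le (k : ℕ) {x : ℝ} (hx : 0 < x) :
    ‖airyMoment k x‖ ≤ (2 / x) ^ (k + 1) * Real.Gamma (k + 1) := by
  have h := Real.integral_rpow_mul_exp_neg_mul_Ioi (a := k + 1) (r := x / 2)
    (by positivity) (by positivity)
  have h' : (1 / (x / 2)) ^ ((k : ℝ) + 1) = (2 / x) ^ (k + 1) := by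
    rw [one_div_div]
    exact_mod_cast Real.rpow_natCast (2 / x) (k + 1)
  rw [← h', ← h]
  have hint : IntegrableOn (fun t : ℝ => t ^ ((k : ℝ) + 1 - 1) * Real.exp (-(x / 2 * t)))
      (Set.Ioi 0) := by
    by_contra hcon
    rw [integral_undef hcon] at h
    have : 0 < (1 / (x / 2)) ^ ((k : ℝ) + 1) * Real.Gamma (k + 1) :=
      mul_pos (by positivity) (Real.Gamma_pos_of_pos (by positivity))
    linarith
  refine norm_integral_le_of_norm_le hint ?_
  filter_upwards [ae_restrict_mem measurableSet_Ioi] with s hs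
  have hs' : (0 : ℝ) ≤ s := le_of_lt hs
  rw [norm_airyKernel k x hs', add_sub_cancel_right, Real.rpow_natCast]
  gcongr
  have : 0 ≤ s ^ 3 := by positivity
  linarith

theorem airyMoment_apply_zero (k : ℕ) :
    airyMoment k 0 =
      (((1 / 3 : ℝ) ^ (-((k : ℝ) + 1) / 3) * (1 / 3) * Real.Gamma (((k : ℝ) + 1) / 3) : ℝ) : ℂ) := by
  rw [← _root_.integral_rpow_mul_exp_neg_mul_rpow (p := 3) (q := k) (b := 1 / 3) (by norm_num)
    (by linarith [(Nat.cast_nonneg k : (0 : ℝ) ≤ k)]) (by norm_num), ← integral_complex_ofReal,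
    airyMoment]
  refine setIntegral_congr_fun measurableSet_Ioi fun s hs => ?_
  have : s ^ (3 : ℝ) = s ^ 3 := by exact_mod_cast Real.rpow_natCast s 3
  simp only [airyKernel, Real.rpow_natCast, this]
  push_cast
  congr 2
  ring

/-- The real Airy function, written as an absolutely convergent integral. -/
noncomputable def realAiry (x : ℝ) : ℝ := ((⟨√3 / 2, 1 / 2⟩ : ℂ) * airyMoment 0 x).re / Real.pi

/-- The derivative of `realAiry`. -/
noncomputable def realAiryDeriv (x : ℝ) : ℝ :=
  ((⟨√3 / 2, 1 / 2⟩ : ℂ) * (cubeRoot * airyMoment 1 x)).re / Real.pi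

theorem hasDerivAt_re {f : ℝ → ℂ} {f' : ℂ} {x : ℝ} (h : HasDerivAt f f' x) :
    HasDerivAt (fun t => (f t).re) f'.re x :=
  Complex.reCLM.hasFDerivAt.comp_hasDerivAt x h

theorem hasDerivAt_realAiry (x : ℝ) : HasDerivAt realAiry (realAiryDeriv x) x :=
  (hasDerivAt_re ((hasDerivAt_airyMoment 0 x).const_mul _)).div_const _

theorem hasDerivAt_realAiryDeriv (x : ℝ) : HasDerivAt realAiryDeriv (x * realAiry x) x := by
  refine ((hasDerivAt_re (((hasDerivAt_airyMoment 1 x).const_mul cubeRoot).const_mul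
    (⟨√3 / 2, 1 / 2⟩ : ℂ))).div_const Real.pi).congr_deriv ?_
  have h3 : √3 * √3 = 3 := Real.mul_self_sqrt (by norm_num)
  have h1 : (⟨√3 / 2, 1 / 2⟩ : ℂ) * cubeRoot ^ 2 = -Complex.I := by
    rw [cubeRoot_sq]
    apply Complex.ext <;> simp <;> nlinarith
  have h2 : (⟨√3 / 2, 1 / 2⟩ : ℂ) * (cubeRoot * (cubeRoot * airyMoment (1 + 1) x)) =
      -Complex.I + x * ((⟨√3 / 2, 1 / 2⟩ : ℂ) * airyMoment 0 x) := by
    rw [show airyMoment (1 + 1) x = _ from airyMoment_two x]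
    linear_combination h1 +
      (⟨√3 / 2, 1 / 2⟩ : ℂ) * x * airyMoment 0 x * cubeRoot_pow_three
  rw [h2, realAiry, Complex.add_re, Complex.re_ofReal_mul]
  simp [mul_div_assoc]

theorem Gamma_third_mul_Gamma_two_thirds :
    Real.Gamma (1 / 3) * Real.Gamma (2 / 3) = 2 * Real.pi / √3 := by
  have h := Real.Gamma_mul_Gamma_one_sub (1 / 3)
  rw [show (1 : ℝ) - 1 / 3 = 2 / 3 by norm_num, show Real.pi * (1 / 3) = Real.pi / 3 by ring,
    Real.sin_pi_div_three] at h
  rw [h]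
  field_simp

theorem realAiry_zero : realAiry 0 = (3 : ℝ) ^ (-(2 : ℝ) / 3) / Real.Gamma (2 / 3) := by
  have hG : 0 < Real.Gamma (2 / 3) := Real.Gamma_pos_of_pos (by norm_num)
  have hpow : (1 / 3 : ℝ) ^ (-((0 : ℝ) + 1) / 3) * (1 / 3) = 3 ^ (-(2 : ℝ) / 3) := by
    rw [one_div, Real.inv_rpow (by norm_num), ← Real.rpow_neg (by norm_num),
      ← Real.rpow_neg_one (3 : ℝ), ← Real.rpow_add (by norm_num)]
    norm_num
  have hGG := Gamma_third_mul_Gamma_two_thirds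
  rw [realAiry, airyMoment_apply_zero, mul_comm, Complex.re_ofReal_mul, Nat.cast_zero, hpow]
  rw [eq_div_iff hG.ne', zero_add]
  simp only
  rw [show ∀ a b c d e : ℝ, a * b * c / d * e = a * c / d * (b * e) by intros; ring, hGG]
  field_simp

theorem realAiryDeriv_zero :
    realAiryDeriv 0 = -(3 : ℝ) ^ (-(1 : ℝ) / 3) / Real.Gamma (1 / 3) := by
  have hG : 0 < Real.Gamma (1 / 3) := Real.Gamma_pos_of_pos (by norm_num)
  have hpow : (1 / 3 : ℝ) ^ (-((1 : ℝ) + 1) / 3) * (1 / 3) = 3 ^ (-(1 : ℝ) / 3) := by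
    rw [one_div, Real.inv_rpow (by norm_num), ← Real.rpow_neg (by norm_num),
      ← Real.rpow_neg_one (3 : ℝ), ← Real.rpow_add (by norm_num)]
    norm_num
  have hGG := Gamma_third_mul_Gamma_two_thirds
  have hre : ((⟨√3 / 2, 1 / 2⟩ : ℂ) * cubeRoot).re = -√3 / 2 := by
    simp [cubeRoot]
    ring
  rw [realAiryDeriv, airyMoment_apply_zero, ← mul_assoc, mul_comm, Complex.re_ofReal_mul, hre,
    Nat.cast_one, hpow, eq_div_iff hG.ne', show ((1 : ℝ) + 1) / 3 = 2 / 3 by norm_num]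
  rw [show ∀ a b c d e : ℝ, a * b * c / d * e = a * c / d * (e * b) by intros; ring, hGG]
  field_simp

theorem abs_realAiry_le {x : ℝ} (hx : 0 < x) : |realAiry x| ≤ 2 / x := by
  have hd : ‖(⟨√3 / 2, 1 / 2⟩ : ℂ)‖ = 1 := by
    rw [← sq_eq_sq₀ (norm_nonneg _) zero_le_one, Complex.sq_norm, Complex.normSq_mk]
    nlinarith [Real.mul_self_sqrt (show (0 : ℝ) ≤ 3 by norm_num)]
  rw [realAiry, abs_div, abs_of_pos Real.pi_pos, div_le_iff₀ Real.pi_pos]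
  have h1 := Complex.abs_re_le_norm ((⟨√3 / 2, 1 / 2⟩ : ℂ) * airyMoment 0 x)
  rw [norm_mul, hd, one_mul] at h1
  have h2 := norm_airyMoment_le 0 hx
  simp at h2
  have : 0 < 2 / x := by positivity
  nlinarith [Real.pi_gt_three]

theorem abs_realAiryDeriv_le {x : ℝ} (hx : 0 < x) : |realAiryDeriv x| ≤ (2 / x) ^ 2 := by
  have hd : ‖(⟨√3 / 2, 1 / 2⟩ : ℂ)‖ = 1 := by
    rw [← sq_eq_sq₀ (norm_nonneg _) zero_le_one, Complex.sq_norm, Complex.normSq_mk]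
    nlinarith [Real.mul_self_sqrt (show (0 : ℝ) ≤ 3 by norm_num)]
  have hc : ‖cubeRoot‖ = 1 := by
    refine (pow_eq_one_iff_of_nonneg (norm_nonneg _) three_ne_zero).1 ?_
    rw [← norm_pow, cubeRoot_pow_three, norm_one]
  rw [realAiryDeriv, abs_div, abs_of_pos Real.pi_pos, div_le_iff₀ Real.pi_pos]
  have h1 := Complex.abs_re_le_norm ((⟨√3 / 2, 1 / 2⟩ : ℂ) * (cubeRoot * airyMoment 1 x))
  rw [norm_mul, norm_mul, hd, hc, one_mul, one_mul] at h1
  have h2 := norm_airyMoment_le 1 hx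
  rw [Nat.cast_one, show (1 : ℝ) + 1 = 2 by norm_num, Real.Gamma_two, mul_one] at h2
  have : 0 < (2 / x) ^ 2 := by positivity
  nlinarith [Real.pi_gt_three]

/-- The primitive `x Ai² - Ai'²` of `Ai²` vanishes at infinity. -/
theorem tendsto_realAiry_primitive :
    Tendsto (fun x => x * realAiry x ^ 2 - realAiryDeriv x ^ 2) atTop (nhds 0) := by
  have hinv : Tendsto (fun x : ℝ => 2 / x) atTop (nhds 0) := tendsto_const_nhds.div_atTop tendsto_id
  have hA : Tendsto (fun x : ℝ => 2 * (2 / x)) atTop (nhds 0) := by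
    simpa using hinv.const_mul 2
  have hB : Tendsto (fun x : ℝ => ((2 / x) ^ 2) ^ 2) atTop (nhds 0) := by
    simpa using (hinv.pow 2).pow 2
  have h1 : Tendsto (fun x => x * realAiry x ^ 2) atTop (nhds 0) := by
    refine squeeze_zero' ?_ ?_ hA
    · filter_upwards [eventually_gt_atTop 0] with x hx
      positivity
    · filter_upwards [eventually_gt_atTop 0] with x hx
      calc x * realAiry x ^ 2 = x * |realAiry x| ^ 2 := by rw [sq_abs]
        _ ≤ x * (2 / x) ^ 2 := by gcongr; exact abs_realAiry_le hx
        _ = 2 * (2 / x) := by field_simp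
  have h2 : Tendsto (fun x => realAiryDeriv x ^ 2) atTop (nhds 0) := by
    refine squeeze_zero' (Eventually.of_forall fun _ => sq_nonneg _) ?_ hB
    filter_upwards [eventually_gt_atTop 0] with x hx
    rw [← sq_abs]
    gcongr
    exact abs_realAiryDeriv_le hx
  simpa using h1.sub h2

theorem integral_sq_realAiry (a : ℝ) :
    ∫ x in Set.Ioi (0 : ℝ), realAiry (x - a) ^ 2 =
      a * realAiry (-a) ^ 2 + realAiryDeriv (-a) ^ 2 := by
  have hd : ∀ x ∈ Set.Ici (0 : ℝ), HasDerivAt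
      (fun x => (x - a) * realAiry (x - a) ^ 2 - realAiryDeriv (x - a) ^ 2)
      (realAiry (x - a) ^ 2) x := by
    intro x _
    have h0 := (hasDerivAt_id x).sub_const a
    have h1 := (hasDerivAt_realAiry (x - a)).comp_sub_const x a
    have h2 := (hasDerivAt_realAiryDeriv (x - a)).comp_sub_const x a
    refine ((h0.mul (h1.pow 2)).sub (h2.pow 2)).congr_deriv ?_
    simp
    ring
  have ht := tendsto_realAiry_primitive.comp (tendsto_atTop_add_const_right atTop (-a) tendsto_id)
  rw [integral_Ioi_of_hasDerivAt_of_nonneg' hd (fun _ _ => sq_nonneg _) ht]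
  simp only [zero_sub]
  ring

/-- The characterization of the Airy function by its differential equation and Cauchy data. -/
structure IsAiry (Ai : ℂ → ℂ) : Prop where
  hasDerivAt : ∀ z, HasDerivAt Ai (deriv Ai z) z
  hasDerivAt_deriv : ∀ z, HasDerivAt (deriv Ai) (z * Ai z) z
  apply_zero : Ai 0 = realAiry 0
  deriv_zero : deriv Ai 0 = realAiryDeriv 0

namespace IsAiry

variable {Ai : ℂ → ℂ}

theorem apply_ofReal (h : IsAiry Ai) (x : ℝ) : Ai x = realAiry x := by
  refine sub_eq_zero.1 (eq_zero_of_second_order_linear (q := fun t => (t : ℂ))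
    Complex.continuous_ofReal (y := fun t : ℝ => Ai t - realAiry t)
    (y' := fun t : ℝ => deriv Ai t - realAiryDeriv t) (fun t => ?_) (fun t => ?_) ?_ ?_ x)
  · exact (h.hasDerivAt t).comp_ofReal.sub (hasDerivAt_realAiry t).ofReal_comp
  · refine ((h.hasDerivAt_deriv t).comp_ofReal.sub
      (hasDerivAt_realAiryDeriv t).ofReal_comp).congr_deriv ?_
    push_cast
    ring
  · simp [h.apply_zero]
  · simp [h.deriv_zero]

theorem deriv_ofReal (h : IsAiry Ai) (x : ℝ) : deriv Ai x = realAiryDeriv x := by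
  have h1 := (h.hasDerivAt x).comp_ofReal
  have h2 := (hasDerivAt_realAiry x).ofReal_comp
  simp only [h.apply_ofReal] at h1
  exact h1.unique h2

theorem hasDerivAt_rotated (h : IsAiry Ai) (c : ℂ) (w : ℝ) :
    HasDerivAt (fun w : ℝ => c * Ai (c * w)) (c ^ 2 * deriv Ai (c * w)) w := by
  have h1 : HasDerivAt (fun z : ℂ => c * z) c (w : ℂ) := by
    simpa using (hasDerivAt_id (w : ℂ)).const_mul c
  exact (((h.hasDerivAt (c * w)).comp (w : ℂ) h1).const_mul c).comp_ofReal.congr_deriv (by ring)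

/-- If `c ^ 3 = -1`, then `y w = c * Ai (c * w)` has second derivative `-w * y w`. -/
theorem hasDerivAt_rotated_deriv (h : IsAiry Ai) {c : ℂ} (hc : c ^ 3 = -1) (w : ℝ) :
    HasDerivAt (fun w : ℝ => c ^ 2 * deriv Ai (c * w)) (-(w : ℂ) * (c * Ai (c * w))) w := by
  have h1 : HasDerivAt (fun z : ℂ => c * z) c (w : ℂ) := by
    simpa using (hasDerivAt_id (w : ℂ)).const_mul c
  refine (((h.hasDerivAt_deriv (c * w)).comp (w : ℂ) h1).const_mul
    (c ^ 2)).comp_ofReal.congr_deriv ?_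
  linear_combination (c * w * Ai (c * w)) * hc

/-- The connection formula between three rotated Airy functions. -/
theorem apply_neg (h : IsAiry Ai) {c d : ℂ} (hc : c ^ 3 = -1) (hd : d ^ 3 = -1) (hcd : c + d = 1)
    (w : ℝ) : c * Ai (c * w) + d * Ai (d * w) = Ai (-(w : ℂ)) := by
  have hmul : c * d = 1 := by
    linear_combination
      ((c + d) ^ 2 + (c + d) + 1 - 3 * c * d) / 3 * hcd - (hc + hd) / 3
  have hcd2 : c ^ 2 + d ^ 2 = -1 := by
    linear_combination (c + d + 1) * hcd - 2 * hmul
  have hm : (-1 : ℂ) ^ 3 = -1 := by norm_num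
  have h0 := eq_zero_of_second_order_linear (q := fun t => -(t : ℂ))
    (by fun_prop) (y := fun t : ℝ => c * Ai (c * t) + d * Ai (d * t) + -1 * Ai (-1 * t))
    (y' := fun t : ℝ => c ^ 2 * deriv Ai (c * t) + d ^ 2 * deriv Ai (d * t) +
      (-1) ^ 2 * deriv Ai (-1 * t))
    (fun t => ((h.hasDerivAt_rotated c t).add (h.hasDerivAt_rotated d t)).add
      (h.hasDerivAt_rotated (-1) t))
    (fun t => (((h.hasDerivAt_rotated_deriv hc t).add (h.hasDerivAt_rotated_deriv hd t)).add
      (h.hasDerivAt_rotated_deriv hm t)).congr_deriv (by ring)) ?_ ?_ w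
  · rw [neg_one_mul, neg_one_mul] at h0
    linear_combination h0
  · simp only [Complex.ofReal_zero, mul_zero]
    linear_combination Ai 0 * hcd
  · simp only [Complex.ofReal_zero, mul_zero]
    linear_combination deriv Ai 0 * hcd2

/-- Complex conjugation exchanges the two rotated Airy functions. -/
theorem conj_rotated (h : IsAiry Ai) {c : ℂ} (hc : c ^ 3 = -1) (w : ℝ) :
    star (c * Ai (c * w)) = star c * Ai (star c * w) := by
  have hd : star c ^ 3 = -1 := by rw [← star_pow, hc, star_neg, star_one]
  refine sub_eq_zero.1 (eq_zero_of_second_order_linear (q := fun t => -(t : ℂ))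
    (by fun_prop) (y := fun t : ℝ => star (c * Ai (c * t)) - star c * Ai (star c * t))
    (y' := fun t : ℝ => star (c ^ 2 * deriv Ai (c * t)) - star c ^ 2 * deriv Ai (star c * t))
    (fun t => (h.hasDerivAt_rotated c t).star.sub (h.hasDerivAt_rotated (star c) t))
    (fun t => ((h.hasDerivAt_rotated_deriv hc t).star.sub
      (h.hasDerivAt_rotated_deriv hd t)).congr_deriv ?_) ?_ ?_ w)
  · simp
    ring
  · simp [h.apply_zero]
  · simp [h.deriv_zero]

theorem realAiry_mul_deriv_zero : realAiry 0 * realAiryDeriv 0 = -1 / (2 * √3 * Real.pi) := by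
  have h3 : √3 * √3 = 3 := Real.mul_self_sqrt (by norm_num)
  have hpow : (3 : ℝ) ^ (-(2 : ℝ) / 3) * 3 ^ (-(1 : ℝ) / 3) = 1 / 3 := by
    rw [← Real.rpow_add (by norm_num), show -(2 : ℝ) / 3 + -1 / 3 = -1 by norm_num,
      Real.rpow_neg_one, one_div]
  rw [realAiry_zero, realAiryDeriv_zero, div_mul_div_comm, mul_neg, hpow,
    mul_comm (Real.Gamma (2 / 3)), Gamma_third_mul_Gamma_two_thirds]
  field_simp
  nlinarith

/-- The Wronskian of the two rotated Airy functions. -/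
theorem wronskian_rotated (h : IsAiry Ai) {c d : ℂ} (hc : c ^ 3 = -1) (hd : d ^ 3 = -1)
    (hsub : c - d = √3 * Complex.I) (hmul : c * d = 1) (w : ℝ) :
    c ^ 2 * deriv Ai (c * w) * (d * Ai (d * w)) - c * Ai (c * w) * (d ^ 2 * deriv Ai (d * w)) =
      -Complex.I / (2 * Real.pi) := by
  have hder : ∀ t : ℝ, HasDerivAt (fun w : ℝ => c ^ 2 * deriv Ai (c * w) * (d * Ai (d * w)) -
      c * Ai (c * w) * (d ^ 2 * deriv Ai (d * w))) 0 t := fun t =>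
    (((h.hasDerivAt_rotated_deriv hc t).mul (h.hasDerivAt_rotated d t)).sub
      ((h.hasDerivAt_rotated c t).mul (h.hasDerivAt_rotated_deriv hd t))).congr_deriv (by ring)
  have hconst := is_const_of_deriv_eq_zero (fun t => (hder t).differentiableAt)
    (fun t => (hder t).deriv) w 0
  refine hconst.trans ?_
  have hs : (√3 : ℂ) ≠ 0 := by
    exact_mod_cast (by positivity : √3 ≠ 0)
  have hpi : (Real.pi : ℂ) ≠ 0 := by exact_mod_cast Real.pi_ne_zero
  have hab : Ai 0 * deriv Ai 0 = -1 / (2 * √3 * Real.pi) := by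
    rw [h.apply_zero, h.deriv_zero]
    exact_mod_cast congrArg Complex.ofReal realAiry_mul_deriv_zero
  simp only [Complex.ofReal_zero, mul_zero]
  calc _ = (c * d) * (c - d) * (Ai 0 * deriv Ai 0) := by ring
    _ = _ := by
      rw [hmul, hsub, hab]
      field_simp

end IsAiry

/-- A continuous real phase of a differentiable function is differentiable. -/
theorem hasDerivAt_of_cexp_eq {L : ℝ → ℝ} (hL : Continuous L) {f : ℝ → ℂ} {f' : ℂ} {w : ℝ}
    (hexp : ∀ t, Complex.exp (-(L t : ℂ) * Complex.I) = f t) (hf : HasDerivAt f f' w) :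
    HasDerivAt (fun t => (L t : ℂ)) (Complex.I * f' / f w) w := by
  have hne : f w ≠ 0 := by rw [← hexp]; exact Complex.exp_ne_zero _
  have h1 : HasDerivAt (fun t => (L w : ℂ) + Complex.I * Complex.log (f t / f w))
      (Complex.I * (f' / f w / (f w / f w))) w := by
    refine (((hf.div_const (f w)).clog_real ?_).const_mul Complex.I).const_add (L w : ℂ)
    rw [div_self hne]
    exact Complex.one_mem_slitPlane
  rw [div_self hne, div_one, ← mul_div_assoc] at h1
  refine h1.congr_of_eventuallyEq ?_
  have hev : ∀ᶠ t in nhds w, |L t - L w| < Real.pi := by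
    have : Tendsto (fun t => |L t - L w|) (nhds w) (nhds 0) := by
      simpa using ((hL.tendsto w).sub_const (L w)).abs
    exact this.eventually_lt_const Real.pi_pos
  filter_upwards [hev] with t ht
  have : f t / f w = Complex.exp (((-(L t - L w) : ℝ) : ℂ) * Complex.I) := by
    rw [← hexp, ← hexp, ← Complex.exp_sub]
    congr 1
    push_cast
    ring
  rw [abs_lt] at ht
  rw [this, Complex.log_exp]
  · push_cast
    linear_combination ((L t : ℂ) - L w) * Complex.I_sq
  · simp; linarith
  · simp; linarith

/-- A strictly increasing continuous function starting in `(0, p)` whose values are multiples of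
`p` exactly at the points of an increasing sequence takes the value `k p` at the `k`-th point. -/
theorem eq_nat_mul_of_strictMono {L : ℝ → ℝ} (hL : Continuous L) (hmono : StrictMono L)
    {p : ℝ} (hp : 0 < p) (h0 : 0 < L 0) (h0p : L 0 < p) {ω : ℕ → ℝ} (hω_pos : 0 < ω 1)
    (hω : StrictMonoOn ω {k | 1 ≤ k})
    (hz : ∀ w, (∃ n : ℤ, L w = p * n) ↔ ∃ k : ℕ, 1 ≤ k ∧ w = ω k) {k : ℕ} (hk : 1 ≤ k) :
    L (ω k) = p * k := by
  have step : ∀ (a b : ℝ) (m n : ℤ), a < b → L a < p * (m + 1) → p * m < L b → L b = p * n →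
      (∀ j, 1 ≤ j → a < ω j → b ≤ ω j) → L b = p * (m + 1) := by
    intro a b m n hab ha hb hn hj
    have hmn : m < n := by
      rw [hn] at hb
      exact_mod_cast lt_of_mul_lt_mul_left hb hp.le
    rcases (Int.add_one_le_iff.2 hmn).eq_or_lt with h | h
    · rw [hn, ← h]; push_cast; ring
    · exfalso
      have hlt : p * (m + 1) < L b := by
        rw [hn]
        exact mul_lt_mul_of_pos_left (by exact_mod_cast h) hp
      obtain ⟨x, hx, hxL⟩ := intermediate_value_Ioo hab.le hL.continuousOn ⟨ha, hlt⟩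
      obtain ⟨j, hj1, rfl⟩ := (hz x).1 ⟨m + 1, by rw [hxL]; push_cast; ring⟩
      exact absurd hx.2 (not_lt.2 (hj j hj1 hx.1))
  induction k, hk using Nat.le_induction with
  | base =>
    obtain ⟨n, hn⟩ := (hz (ω 1)).2 ⟨1, le_rfl, rfl⟩
    have := step 0 (ω 1) 0 n hω_pos (by simpa using h0p)
      (by simpa using h0.trans (hmono hω_pos)) hn
      (fun j hj _ => hω.monotoneOn (Set.mem_ofPred.2 le_rfl) hj hj)
    simpa using this
  | succ k hk ih =>
    have hlt : ω k < ω (k + 1) := hω hk (Set.mem_ofPred.2 (by lia)) (Nat.lt_succ_self k)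
    obtain ⟨n, hn⟩ := (hz (ω (k + 1))).2 ⟨k + 1, by lia, rfl⟩
    have := step (ω k) (ω (k + 1)) k n hlt
      (by rw [ih]; push_cast; exact mul_lt_mul_of_pos_left (lt_add_one _) hp)
      (by have := hmono hlt; rw [ih] at this; exact_mod_cast this) hn
      (fun j hj hkj => hω.monotoneOn (Set.mem_ofPred.2 (by lia)) hj
        (Nat.succ_le_of_lt ((hω.lt_iff_lt hk hj).1 hkj)))
    rw [this]
    push_cast
    ring

theorem cexp_pi_div_three : Complex.exp ((Real.pi / 3 : ℂ) * Complex.I) = ⟨1 / 2, √3 / 2⟩ := by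
  rw [Complex.exp_mul_I, show (Real.pi / 3 : ℂ) = ((Real.pi / 3 : ℝ) : ℂ) by push_cast; rfl,
    ← Complex.ofReal_cos, ← Complex.ofReal_sin, Real.cos_pi_div_three, Real.sin_pi_div_three]
  apply Complex.ext <;> simp

theorem cexp_neg_pi_div_three :
    Complex.exp (-(Real.pi / 3 : ℂ) * Complex.I) = star (⟨1 / 2, √3 / 2⟩ : ℂ) := by
  rw [← cexp_pi_div_three, Complex.star_def, ← Complex.exp_conj, map_mul, Complex.conj_I,
    show (Real.pi / 3 : ℂ) = ((Real.pi / 3 : ℝ) : ℂ) by push_cast; rfl, Complex.conj_ofReal,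
    neg_mul, mul_neg]

/-- `Ai(−ω) = 0` iff `L(ω) ∈ 2πℕ*`; in particular `L(ω_k) = 2πk` and
`L'(ω_k) = 2π ∫₀^∞ Ai(x−ω_k)² dx`. -/
theorem Airy_zeros_via_L
    (Ai : ℂ → ℂ)
    (hAi_diff : Differentiable ℂ Ai)
    (hAi_diff' : Differentiable ℂ (deriv Ai))
    (hAi_ode : ∀ z : ℂ, deriv (deriv Ai) z = z * Ai z)
    (hAi_zero : Ai 0 = (3 : ℂ) ^ (-(2 : ℂ)/3) / Complex.Gamma (2/3))
    (hAi_zero' : deriv Ai 0 = -((3 : ℂ) ^ (-(1 : ℂ)/3)) / Complex.Gamma (1/3))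
    (hAi_real : ∀ x : ℝ, (Ai x).im = 0)
    (ω : ℕ → ℝ)
    (hω_pos : 0 < ω 1)
    (hω_mono : StrictMonoOn ω {k | 1 ≤ k})
    (hω_tendsto : Tendsto ω atTop atTop)
    (hAi_zeros : ∀ x : ℝ, Ai x = 0 ↔ ∃ k : ℕ, 1 ≤ k ∧ x = -ω k)
    (L : ℝ → ℝ)
    (hL_cont : Continuous L)
    (hL_zero : L 0 = Real.pi / 3)
    (hAp_ne : ∀ w : ℝ, Aplus Ai w ≠ 0)
    (hL_char : ∀ w : ℝ, Complex.exp (-(L w : ℂ) * Complex.I) = -(Aminus Ai w) / (Aplus Ai w)) :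
    (∀ w : ℝ, Ai (-(w : ℂ)) = 0 ↔ ∃ k : ℕ, 1 ≤ k ∧ L w = 2 * Real.pi * k) ∧
    (∀ k : ℕ, 1 ≤ k → L (ω k) = 2 * Real.pi * k) ∧
    (∀ k : ℕ, 1 ≤ k →
      deriv L (ω k) = 2 * Real.pi * ∫ x in Set.Ioi (0:ℝ), (Ai ((x - ω k : ℝ))).re ^ 2) := by
  have h3 : √3 * √3 = 3 := Real.mul_self_sqrt (by norm_num)
  have h3' : (√3 : ℂ) * √3 = 3 := by exact_mod_cast h3
  have hA : IsAiry Ai := by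
    refine ⟨fun z => (hAi_diff z).hasDerivAt, fun z => ?_, ?_, ?_⟩
    · rw [← hAi_ode]
      exact (hAi_diff' z).hasDerivAt
    · rw [hAi_zero, realAiry_zero, Complex.ofReal_div, Complex.ofReal_cpow (by norm_num),
        ← Complex.Gamma_ofReal]
      push_cast
      rfl
    · rw [hAi_zero', realAiryDeriv_zero, Complex.ofReal_div, Complex.ofReal_neg,
        Complex.ofReal_cpow (by norm_num), ← Complex.Gamma_ofReal]
      push_cast
      rfl
  obtain ⟨c, hc⟩ : ∃ c : ℂ, c = ⟨1 / 2, √3 / 2⟩ := ⟨_, rfl⟩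
  have hc' : c = 1 / 2 + √3 / 2 * Complex.I := by
    rw [hc]; apply Complex.ext <;> simp
  have hd' : star c = 1 / 2 - √3 / 2 * Complex.I := by
    rw [hc]; apply Complex.ext <;> simp
  have hadd : star c + c = 1 := by rw [hd', hc']; ring
  have hmul : c * star c = 1 := by
    rw [hd', hc']
    linear_combination -(√3 : ℂ) * √3 / 4 * Complex.I_sq + h3' / 4
  have hsub : c - star c = √3 * Complex.I := by rw [hd', hc']; ring
  have hc3 : c ^ 3 = -1 := by
    linear_combination (c ^ 2 + c) * hadd - (c + 1) * hmul
  have hd3 : star c ^ 3 = -1 := by rw [← star_pow, hc3, star_neg, star_one]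
  have hP : ∀ w : ℝ, Aplus Ai w = star c * Ai (star c * w) := fun w => by
    rw [Aplus, cexp_neg_pi_div_three, hc]
  have hM : ∀ w : ℝ, Aminus Ai w = c * Ai (c * w) := fun w => by
    rw [Aminus, cexp_pi_div_three, hc]
  have hMP : ∀ w : ℝ, Aminus Ai w = star (Aplus Ai w) := fun w => by
    rw [hP, hA.conj_rotated hd3, star_star, hM]
  have hconn : ∀ w : ℝ, Aplus Ai w + Aminus Ai w = Ai (-(w : ℂ)) := fun w => by
    rw [hP, hM, hA.apply_neg hd3 hc3 hadd]
  have hW := hA.wronskian_rotated hc3 hd3 hsub hmul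
  have hpi : (Real.pi : ℂ) ≠ 0 := by exact_mod_cast Real.pi_ne_zero
  have hnorm : ∀ w : ℝ, Aminus Ai w * Aplus Ai w = ((‖Aplus Ai w‖ ^ 2 : ℝ) : ℂ) := fun w => by
    rw [hMP, mul_comm, Complex.star_def, Complex.mul_conj, Complex.normSq_eq_norm_sq]
  have hM_ne : ∀ w : ℝ, Aminus Ai w ≠ 0 := fun w => by
    rw [hMP]; exact star_ne_zero.2 (hAp_ne w)
  have hderivL : ∀ w : ℝ, HasDerivAt L (1 / (2 * Real.pi * ‖Aplus Ai w‖ ^ 2)) w := by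
    intro w
    have h1 := hA.hasDerivAt_rotated c w
    have h2 := hA.hasDerivAt_rotated (star c) w
    simp only [← hM, ← hP] at h1 h2
    have h := hasDerivAt_re (hasDerivAt_of_cexp_eq hL_cont hL_char (h1.neg.div h2 (hAp_ne w)))
    refine h.congr_deriv ?_
    rw [← Complex.ofReal_re (1 / (2 * Real.pi * ‖Aplus Ai w‖ ^ 2))]
    congr 1
    rw [Complex.ofReal_div, Complex.ofReal_mul, ← hnorm]
    have hWw := hW w
    rw [← hM, ← hP] at hWw
    have hp := hAp_ne w
    have hm := hM_ne w
    push_cast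
    generalize c ^ 2 * deriv Ai (c * w) = M' at hWw ⊢
    generalize star c ^ 2 * deriv Ai (star c * w) = P' at hWw ⊢
    have hWw' : M' * Aplus Ai w - Aminus Ai w * P' = -Complex.I / (2 * Real.pi) := hWw
    rw [eq_div_iff (mul_ne_zero two_ne_zero hpi)] at hWw'
    rw [Pi.neg_apply]
    field_simp
    linear_combination Complex.I * hWw' - Complex.I_sq
  have hmono : StrictMono L := strictMono_of_deriv_pos fun w => by
    rw [(hderivL w).deriv]
    have := norm_pos_iff.2 (hAp_ne w)
    have := Real.pi_pos
    positivity
  have hzero_iff : ∀ w : ℝ, Ai (-(w : ℂ)) = 0 ↔ ∃ n : ℤ, L w = 2 * Real.pi * n := by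
    intro w
    rw [← hconn]
    have h1 : Aplus Ai w + Aminus Ai w = 0 ↔ Complex.exp (-(L w : ℂ) * Complex.I) = 1 := by
      rw [hL_char, div_eq_one_iff_eq (hAp_ne w), neg_eq_iff_add_eq_zero, add_comm]
    rw [h1, Complex.exp_eq_one_iff]
    constructor
    · rintro ⟨n, hn⟩
      refine ⟨-n, ?_⟩
      have := congrArg Complex.im hn
      simp at this
      push_cast
      linarith
    · rintro ⟨n, hn⟩
      refine ⟨-n, ?_⟩
      rw [hn]
      push_cast
      ring
  have hzero_ω : ∀ w : ℝ, Ai (-(w : ℂ)) = 0 ↔ ∃ k : ℕ, 1 ≤ k ∧ w = ω k := fun w => by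
    rw [← Complex.ofReal_neg, hAi_zeros]
    simp only [neg_inj]
  have hLω : ∀ k : ℕ, 1 ≤ k → L (ω k) = 2 * Real.pi * k := fun k hk =>
    eq_nat_mul_of_strictMono hL_cont hmono Real.two_pi_pos
      (by rw [hL_zero]; positivity) (by rw [hL_zero]; linarith [Real.pi_pos]) hω_pos hω_mono
      (fun w => (hzero_iff w).symm.trans (hzero_ω w)) hk
  refine ⟨fun w => ⟨fun hw => ?_, ?_⟩, hLω, fun k hk => ?_⟩
  · obtain ⟨k, hk, rfl⟩ := (hzero_ω w).1 hw
    exact ⟨k, hk, hLω k hk⟩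
  · rintro ⟨k, -, hk⟩
    exact (hzero_iff w).2 ⟨k, by exact_mod_cast hk⟩
  · have hz : Ai (-(ω k : ℂ)) = 0 := (hzero_ω _).2 ⟨k, hk, rfl⟩
    have hz' : realAiry (-ω k) = 0 := by
      rw [← Complex.ofReal_neg, hA.apply_ofReal] at hz
      exact_mod_cast hz
    have hint : ∫ x in Set.Ioi (0 : ℝ), (Ai ((x - ω k : ℝ))).re ^ 2 =
        realAiryDeriv (-ω k) ^ 2 := by
      simp only [hA.apply_ofReal, Complex.ofReal_re, integral_sq_realAiry, hz']
      ring
    have hMneg : Aminus Ai (ω k) = -Aplus Ai (ω k) := by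
      linear_combination (hconn (ω k)).trans hz
    have hdconn : c ^ 2 * deriv Ai (c * ω k) + star c ^ 2 * deriv Ai (star c * ω k) =
        -(realAiryDeriv (-ω k) : ℂ) := by
      have h1 := (hA.hasDerivAt_rotated (star c) (ω k)).add (hA.hasDerivAt_rotated c (ω k))
      have h2 := hA.hasDerivAt_rotated (-1) (ω k)
      have h3 : (fun w : ℝ => -1 * Ai (-1 * w)) =
          -((fun w : ℝ => star c * Ai (star c * w)) + fun w : ℝ => c * Ai (c * w)) := by
        funext w
        simp only [Pi.neg_apply, Pi.add_apply, hA.apply_neg hd3 hc3 hadd, neg_one_mul]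
      rw [h3] at h2
      have h4 := h1.neg.unique h2
      rw [neg_one_mul, ← Complex.ofReal_neg, hA.deriv_ofReal] at h4
      linear_combination -h4
    have hWk := hW (ω k)
    rw [← hM, ← hP, hMneg] at hWk
    have hkey : Aplus Ai (ω k) * realAiryDeriv (-ω k) = Complex.I / (2 * Real.pi) := by
      linear_combination -hWk + Aplus Ai (ω k) * hdconn
    have hkey' : ‖Aplus Ai (ω k)‖ * |realAiryDeriv (-ω k)| = 1 / (2 * Real.pi) := by
      have := congrArg norm hkey
      simpa [abs_of_pos Real.pi_pos] using this
    rw [(hderivL _).deriv, hint, ← sq_abs (realAiryDeriv (-ω k))]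
    have hp : ‖Aplus Ai (ω k)‖ ≠ 0 := norm_ne_zero_iff.2 (hAp_ne _)
    have hr : |realAiryDeriv (-ω k)| = 1 / (2 * Real.pi) / ‖Aplus Ai (ω k)‖ := by
      rw [eq_div_iff hp, mul_comm, hkey']
    rw [hr]
    have := Real.pi_ne_zero
    field_simp
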